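/- Let d, k ≥ 1 be integers, let G be a finite simple graph without isolated vertices with d-pw(G) ≥ k, and let Z be a d-SMNBP representing ψ(G). Then the number of edges of Z satisfies |Z| ≥ ((8/7)^{⌊k/4⌋/3} − 1)/3; in particular there is an absolute constant c > 0 (independent of d, k and G) with |Z| ≥ c·β^k where β = (8/7)^{1/12}. -/

import Mathlib

/-- A path decomposition of a simple graph `G`: a sequence of bags covering all
vertices and edges such that the bags containing any fixed vertex form an interval. -/
structure PathDecomp {V : Type} (G : SimpleGraph V) where
  len : ℕ
  bag : Fin len → Finset V
  cover_vertex : ∀ v : V, ∃ i, v ∈ bag i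
  cover_edge : ∀ ⦃u v : V⦄, G.Adj u v → ∃ i, u ∈ bag i ∧ v ∈ bag i
  interval : ∀ (v : V) (i j k : Fin len), i ≤ j → j ≤ k → v ∈ bag i → v ∈ bag k → v ∈ bag j

/-- The pathwidth of a simple graph: minimum over path decompositions of
(maximum bag size minus one). -/
noncomputable def pathwidth {V : Type} (G : SimpleGraph V) : ℕ :=
  sInf {k | ∃ D : PathDecomp G, ∀ i, (D.bag i).card ≤ k + 1}

/-- The `d`-pathwidth of `G`: the smallest `k` such that `G` is the union of `d`
subgraphs each of pathwidth at most `k`. -/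
noncomputable def dPathwidth {V : Type} (d : ℕ) (G : SimpleGraph V) : ℕ :=
  sInf {k | ∃ f : Fin d → SimpleGraph V,
    (∀ i, f i ≤ G) ∧ (⨆ i, f i) = G ∧ ∀ i, pathwidth (f i) ≤ k}

/-- The clique-preserving `d`-pathwidth of `G`: as `dPathwidth`, with the extra
requirement that every clique of `G` is a subgraph of some member of the union. -/
noncomputable def cliquePreservingDPathwidth {V : Type} (d : ℕ) (G : SimpleGraph V) : ℕ :=
  sInf {k | ∃ f : Fin d → SimpleGraph V,
    (∀ i, f i ≤ G) ∧ (⨆ i, f i) = G ∧ (∀ i, pathwidth (f i) ≤ k) ∧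
    ∀ s : Set V, G.IsClique s → ∃ i, (f i).IsClique s}

/-- The variables of the CNF `ψ(G)`: vertex variables and edge variables. -/
abbrev PsiVar (V : Type) := V ⊕ Sym2 V

/-- A total assignment to the variables of `ψ(G)`. -/
abbrev Assignment (V : Type) := PsiVar V → Bool

/-- `σ` satisfies the CNF `ψ(G)` whose clauses are `(u ∨ e ∨ v)`
for the edges `e = {u,v}` of `G`. -/
def psiSat {V : Type} (G : SimpleGraph V) (σ : Assignment V) : Prop :=
  ∀ ⦃u v : V⦄, G.Adj u v →
    σ (Sum.inl u) = true ∨ σ (Sum.inr s(u, v)) = true ∨ σ (Sum.inl v) = true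

/-- A (nondeterministic) branching program: a directed multigraph on `Fin n`
with edge set `Fin m`, a source, a sink, and an optional literal labelling
each edge. -/
structure BP (X : Type) where
  n : ℕ
  m : ℕ
  esrc : Fin m → Fin n
  edst : Fin m → Fin n
  source : Fin n
  sink : Fin n
  label : Fin m → Option (X × Bool)

namespace BP

variable {X : Type}

/-- `Z.IsPathFrom u v p`: the edge list `p` forms a directed path from `u` to `v`. -/
def IsPathFrom (Z : BP X) : Fin Z.n → Fin Z.n → List (Fin Z.m) → Prop
  | u, v, [] => u = v
  | u, v, e :: p => Z.esrc e = u ∧ Z.IsPathFrom (Z.edst e) v p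

/-- `v` is reachable from `u`. -/
def Reach (Z : BP X) (u v : Fin Z.n) : Prop := ∃ p, Z.IsPathFrom u v p

/-- `Z` is acyclic. -/
def Acyclic (Z : BP X) : Prop :=
  ∀ (u : Fin Z.n) (p : List (Fin Z.m)), Z.IsPathFrom u u p → p = []

/-- `Z` is a DAG with one source and one sink: no edge enters the source, no edge
leaves the sink, and every vertex lies on a source-sink path. -/
def IsNBP (Z : BP X) : Prop :=
  Z.Acyclic ∧ (∀ e, Z.edst e ≠ Z.source) ∧ (∀ e, Z.esrc e ≠ Z.sink) ∧
    ∀ v : Fin Z.n, Z.Reach Z.source v ∧ Z.Reach v Z.sink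

/-- The number of edges of the path `p` labelled with a literal of variable `x`. -/
def varCount [DecidableEq X] (Z : BP X) (p : List (Fin Z.m)) (x : X) : ℕ :=
  p.countP fun e => (Z.label e).elim false fun l => decide (l.1 = x)

/-- A path is read-once if no variable labels two of its edges. -/
def ReadOnce [DecidableEq X] (Z : BP X) (p : List (Fin Z.m)) : Prop :=
  ∀ x : X, Z.varCount p x ≤ 1

/-- `Z` is a syntactic read-`d`-times BP. -/
def ReadTimes [DecidableEq X] (Z : BP X) (d : ℕ) : Prop :=
  ∀ (u v : Fin Z.n) (p : List (Fin Z.m)), Z.IsPathFrom u v p → ∀ x : X, Z.varCount p x ≤ d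

/-- `Z` is monotone: no negative literal labels an edge. -/
def MonotoneBP (Z : BP X) : Prop :=
  ∀ (e : Fin Z.m) (l : X × Bool), Z.label e = some l → l.2 = true

/-- `Z` is separable with parameter `d`: every source-sink path is the
concatenation of at most `d` read-once subpaths. -/
def Separable [DecidableEq X] (Z : BP X) (d : ℕ) : Prop :=
  ∀ p, Z.IsPathFrom Z.source Z.sink p →
    ∃ ps : List (List (Fin Z.m)), ps.length ≤ d ∧ ps.flatten = p ∧ ∀ q ∈ ps, Z.ReadOnce q

/-- `Z` is a monotone separable syntactic read-`d`-times NBP. -/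
def IsSMNBP [DecidableEq X] (Z : BP X) (d : ℕ) : Prop :=
  Z.IsNBP ∧ Z.MonotoneBP ∧ Z.ReadTimes d ∧ Z.Separable d

/-- The path `p` agrees with the total assignment `σ` (so `p` is consistent
and its set of literals is contained in `σ`). -/
def PathAgrees (Z : BP X) (p : List (Fin Z.m)) (σ : X → Bool) : Prop :=
  ∀ e ∈ p, ∀ l : X × Bool, Z.label e = some l → σ l.1 = l.2

/-- `σ` is a satisfying assignment of `Z`: some consistent source-sink path
carries it. -/
def Sat (Z : BP X) (σ : X → Bool) : Prop :=
  ∃ p, Z.IsPathFrom Z.source Z.sink p ∧ Z.PathAgrees p σ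

end BP

/-- `Z` represents the CNF `ψ(G)`. -/
def RepresentsPsi {V : Type} (G : SimpleGraph V) (Z : BP (PsiVar V)) : Prop :=
  ∀ σ : Assignment V, Z.Sat σ ↔ psiSat G σ

/-! ### Path decompositions from vertex orders with small cut matchings -/

/-- `M` is a matching of `H` all of whose members `(u, v)` have `u ∈ A` and `v ∉ A`. -/
def IsCutMatching {V : Type} (H : SimpleGraph V) (A : Finset V) (M : Finset (V × V)) : Prop :=
  (∀ e ∈ M, e.1 ∈ A ∧ e.2 ∉ A ∧ H.Adj e.1 e.2) ∧
    ∀ e ∈ M, ∀ f ∈ M, e.1 = f.1 ∨ e.2 = f.2 → e = f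

theorem IsCutMatching.exists_extension {V : Type} [Fintype V] [DecidableEq V]
    {H : SimpleGraph V} {A : Finset V} {M₀ : Finset (V × V)} (h₀ : IsCutMatching H A M₀) :
    ∃ M, M₀ ⊆ M ∧ IsCutMatching H A M ∧
      ∀ u ∈ A, ∀ v ∉ A, H.Adj u v → (∃ e ∈ M, e.1 = u) ∨ ∃ e ∈ M, e.2 = v := by
  obtain ⟨M, hle, hmax⟩ :=
    (Set.toFinite {M : Finset (V × V) | IsCutMatching H A M}).exists_le_maximal h₀
  refine ⟨M, hle, hmax.prop, fun u hu v hv huv => ?_⟩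
  by_contra hcon
  push Not at hcon
  obtain ⟨h1, h2⟩ := hcon
  have hins : IsCutMatching H A (insert (u, v) M) := by
    refine ⟨?_, ?_⟩
    · intro e he
      rcases Finset.mem_insert.1 he with rfl | he
      · exact ⟨hu, hv, huv⟩
      · exact hmax.prop.1 e he
    · intro e he f hf hef
      rcases Finset.mem_insert.1 he with rfl | he <;> rcases Finset.mem_insert.1 hf with rfl | hf
      · rfl
      · rcases hef with hef | hef
        · exact absurd hef.symm (h1 f hf)
        · exact absurd hef.symm (h2 f hf)
      · rcases hef with hef | hef
        · exact absurd hef (h1 e he)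
        · exact absurd hef (h2 e he)
      · exact hmax.prop.2 e he f hf hef
  have : insert (u, v) M ⊆ M := hmax.le_of_ge hins (Finset.subset_insert _ _)
  exact h1 _ (this (Finset.mem_insert_self _ _)) rfl

/-- Along an increasing sequence of vertex sets, maximal cut matchings can be chosen so that
an edge is only dropped once it is no longer cut. -/
theorem exists_cutMatching_seq {V : Type} [Fintype V] [DecidableEq V] (H : SimpleGraph V)
    (A : ℕ → Finset V) (hA : ∀ i, A i ⊆ A (i + 1)) :
    ∃ M : ℕ → Finset (V × V), ∀ i, IsCutMatching H (A i) (M i) ∧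
      (∀ u ∈ A i, ∀ v ∉ A i, H.Adj u v → (∃ e ∈ M i, e.1 = u) ∨ ∃ e ∈ M i, e.2 = v) ∧
      ∀ e ∈ M i, e.2 ∉ A (i + 1) → e ∈ M (i + 1) := by
  have hext : ∀ (B : Finset V) (M₀ : Finset (V × V)), ∃ M, IsCutMatching H B M₀ →
      M₀ ⊆ M ∧ IsCutMatching H B M ∧
      ∀ u ∈ B, ∀ v ∉ B, H.Adj u v → (∃ e ∈ M, e.1 = u) ∨ ∃ e ∈ M, e.2 = v := by
    intro B M₀
    by_cases h : IsCutMatching H B M₀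
    · obtain ⟨M, hM⟩ := h.exists_extension
      exact ⟨M, fun _ => hM⟩
    · exact ⟨∅, fun h' => absurd h' h⟩
  choose ext hext using hext
  let M : ℕ → Finset (V × V) := fun i => Nat.rec (ext (A 0) ∅)
    (fun i Mi => ext (A (i + 1)) (Mi.filter fun e => e.2 ∉ A (i + 1))) i
  have hfilter : ∀ i, IsCutMatching H (A i) (M i) →
      IsCutMatching H (A (i + 1)) ((M i).filter fun e => e.2 ∉ A (i + 1)) := by
    intro i hi
    refine ⟨fun e he => ?_, fun e he f hf => ?_⟩
    · rw [Finset.mem_filter] at he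
      exact ⟨hA i (hi.1 e he.1).1, he.2, (hi.1 e he.1).2.2⟩
    · exact hi.2 e (Finset.mem_filter.1 he).1 f (Finset.mem_filter.1 hf).1
  have hempty : IsCutMatching H (A 0) ∅ := ⟨by simp, by simp⟩
  have key : ∀ i, IsCutMatching H (A i) (M i) ∧
      ∀ u ∈ A i, ∀ v ∉ A i, H.Adj u v → (∃ e ∈ M i, e.1 = u) ∨ ∃ e ∈ M i, e.2 = v := by
    intro i
    induction i with
    | zero => exact (hext (A 0) ∅ hempty).2
    | succ i ih => exact (hext (A (i + 1)) _ (hfilter i ih.1)).2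
  refine ⟨M, fun i => ⟨(key i).1, (key i).2, fun e he he2 => ?_⟩⟩
  exact (hext (A (i + 1)) _ (hfilter i (key i).1)).1 (Finset.mem_filter.2 ⟨he, he2⟩)

theorem pathwidth_le_of_cutMatching_card_le {V : Type} [Fintype V] [DecidableEq V]
    (H : SimpleGraph V) (μ : ℕ) (g : V → ℕ)
    (hg : ∀ (A : Finset V) (j : ℕ), (∀ v, g v < j → v ∈ A) → (∀ v ∈ A, g v ≤ j) →
      ∀ M, IsCutMatching H A M → M.card ≤ μ) :
    pathwidth H ≤ 2 * μ + 1 := by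
  obtain ⟨f, hf⟩ : ∃ f : Fin (Fintype.card V) ≃ V, Monotone (g ∘ f) :=
    ⟨(Tuple.sort (g ∘ (Fintype.equivFin V).symm)).trans (Fintype.equivFin V).symm,
      Tuple.monotone_sort (g ∘ (Fintype.equivFin V).symm)⟩
  let r : V → ℕ := fun v => (f.symm v : ℕ)
  let A : ℕ → Finset V := fun i => Finset.univ.filter fun v => r v < i
  have memA : ∀ i v, v ∈ A i ↔ r v < i := fun i v => by simp [A]
  have r_f : ∀ i, r (f i) = i := fun i => by simp [r]
  have r_inj : ∀ u v, r u = r v → u = v := fun u v h => f.symm.injective (Fin.ext h)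
  obtain ⟨M, hM⟩ := exists_cutMatching_seq H A fun i v hv => by
    rw [memA] at hv ⊢; omega
  let C : ℕ → Finset V := fun i => (M i).image Prod.fst ∪ (M i).image Prod.snd
  have memC : ∀ i v, v ∈ C i ↔ (∃ e ∈ M i, e.1 = v) ∨ ∃ e ∈ M i, e.2 = v := fun i v => by
    simp only [C, Finset.mem_union, Finset.mem_image]
  have C_up : ∀ i v, i + 1 ≤ r v → v ∈ C i → v ∈ C (i + 1) := by
    intro i v hv hC
    rw [memC] at hC ⊢
    rcases hC with ⟨e, he, rfl⟩ | ⟨e, he, rfl⟩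
    · have := (memA _ _).1 ((hM i).1.1 e he).1
      omega
    · exact Or.inr ⟨e, (hM i).2.2 e he (by rw [memA]; omega), rfl⟩
  have C_down : ∀ i v, r v < i → v ∈ C (i + 1) → v ∈ C i := by
    intro i v hv hC
    rw [memC] at hC
    rcases hC with ⟨e, he, rfl⟩ | ⟨e, he, rfl⟩
    · obtain ⟨-, h2, hadj⟩ := (hM (i + 1)).1.1 e he
      rw [memA] at h2
      rcases (hM i).2.1 e.1 ((memA _ _).2 hv) e.2 (by rw [memA]; omega) hadj with h | ⟨e', he', h⟩
      · exact (memC _ _).2 (Or.inl h)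
      · have := (hM i).2.2 e' he' (by rw [memA, h]; omega)
        have := (hM (i + 1)).1.2 e' this e he (Or.inr h)
        subst this
        exact (memC _ _).2 (Or.inl ⟨_, he', rfl⟩)
    · have := ((hM (i + 1)).1.1 e he).2.1
      rw [memA] at this
      omega
  have C_up_le : ∀ i j v, i ≤ j → j ≤ r v → v ∈ C i → v ∈ C j := by
    intro i j v hij
    induction j, hij using Nat.le_induction with
    | base => exact fun _ h => h
    | succ j _ ih => exact fun hj h => C_up j v hj (ih (by omega) h)
  have C_down_le : ∀ i j v, i ≤ j → r v < i → v ∈ C j → v ∈ C i := by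
    intro i j v hij
    induction j, hij using Nat.le_induction with
    | base => exact fun _ h => h
    | succ j hj ih => exact fun hi h => ih hi (C_down j v (by omega) h)
  let T : Fin (Fintype.card V) → Finset V := fun i => insert (f i) (C i ∪ C (i + 1))
  have memT : ∀ i v, v ∈ T i ↔ v = f i ∨ v ∈ C i ∨ v ∈ C (i + 1) := fun i v => by simp [T]
  have memT_lt : ∀ (i : Fin (Fintype.card V)) v, (i : ℕ) < r v → (v ∈ T i ↔ v ∈ C (i + 1)) := by
    intro i v hi
    rw [memT]
    refine ⟨?_, fun h => Or.inr (Or.inr h)⟩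
    rintro (rfl | h | h)
    · rw [r_f] at hi; omega
    · exact C_up _ _ hi h
    · exact h
  have memT_gt : ∀ (i : Fin (Fintype.card V)) v, r v < (i : ℕ) → (v ∈ T i ↔ v ∈ C i) := by
    intro i v hi
    rw [memT]
    refine ⟨?_, fun h => Or.inr (Or.inl h)⟩
    rintro (rfl | h | h)
    · rw [r_f] at hi; omega
    · exact h
    · exact C_down _ _ hi h
  have memT_eq : ∀ v, v ∈ T (f.symm v) := fun v => by simp [memT]
  have cover : ∀ u w, r u < r w → H.Adj u w → ∃ i, u ∈ T i ∧ w ∈ T i := by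
    intro u w huw hadj
    have hdom : ∀ s, r u < s → s ≤ r w → u ∈ C s ∨ w ∈ C s := by
      intro s h1 h2
      rcases (hM s).2.1 u ((memA _ _).2 h1) w (by rw [memA]; omega) hadj with h | h
      · exact Or.inl ((memC _ _).2 (Or.inl h))
      · exact Or.inr ((memC _ _).2 (Or.inr h))
    by_cases hw : w ∈ C (r w)
    · have hex : ∃ s, w ∈ C s ∧ s ≤ r w := ⟨_, hw, le_rfl⟩
      classical
      obtain ⟨hs1, hs2⟩ := Nat.find_spec hex
      set s := Nat.find hex with hs
      by_cases hsu : s ≤ r u + 1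
      · exact ⟨f.symm u, memT_eq u, (memT_lt _ _ huw).2 (C_up_le s _ _ hsu huw hs1)⟩
      · have hnot : w ∉ C (s - 1) := fun h =>
          Nat.find_min hex (m := s - 1) (by omega) ⟨h, by omega⟩
        have hu := (hdom (s - 1) (by omega) (by omega)).resolve_right hnot
        have hlt : s - 1 < Fintype.card V := by
          have : r w < Fintype.card V := (f.symm w).2
          omega
        refine ⟨⟨s - 1, hlt⟩, (memT _ _).2 (Or.inr (Or.inl hu)), (memT _ _).2 (Or.inr (Or.inr ?_))⟩
        have : s - 1 + 1 = s := by omega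
        simpa only [this] using hs1
    · have hu := (hdom (r w) huw le_rfl).resolve_right hw
      exact ⟨f.symm w, (memT_gt _ _ huw).2 hu, memT_eq w⟩
  let D : PathDecomp H :=
    { len := Fintype.card V
      bag := T
      cover_vertex := fun v => ⟨f.symm v, memT_eq v⟩
      cover_edge := by
        intro u v huv
        rcases lt_trichotomy (r u) (r v) with h | h | h
        · exact cover u v h huv
        · exact absurd (r_inj _ _ h) huv.ne
        · obtain ⟨i, h1, h2⟩ := cover v u h huv.symm
          exact ⟨i, h2, h1⟩
      interval := by
        intro v i j k hij hjk hi hk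
        have hij' : (i : ℕ) ≤ j := hij
        have hjk' : (j : ℕ) ≤ k := hjk
        rcases lt_trichotomy (j : ℕ) (r v) with h | h | h
        · rw [memT_lt _ _ h]
          rw [memT_lt _ _ (by omega)] at hi
          exact C_up_le _ _ _ (by omega) (by omega) hi
        · have : j = f.symm v := Fin.ext h
          exact this ▸ memT_eq v
        · rw [memT_gt _ _ h]
          rw [memT_gt _ _ (by omega)] at hk
          exact C_down_le _ _ _ hjk' h hk }
  refine Nat.sInf_le ⟨D, fun i => ?_⟩
  have hcard : (M (i + 1)).card ≤ μ := by
    refine hg (A (i + 1)) (g (f i)) (fun v hv => ?_) (fun v hv => ?_) _ (hM (i + 1)).1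
    · rw [memA]
      by_contra hcon
      have : g (f i) ≤ g (f (f.symm v)) := hf (show i ≤ f.symm v from by
        change (i : ℕ) ≤ r v
        omega)
      rw [f.apply_symm_apply] at this
      omega
    · rw [memA] at hv
      have : g (f (f.symm v)) ≤ g (f i) := hf (show f.symm v ≤ i from by
        change r v ≤ (i : ℕ)
        omega)
      rwa [f.apply_symm_apply] at this
  let N := ((M i).filter fun e => e.2 = f i).image Prod.fst
  have hN : N.card ≤ 1 := by
    refine Finset.card_image_le.trans (Finset.card_le_one.2 fun e he e' he' => ?_)
    rw [Finset.mem_filter] at he he'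
    exact (hM i).1.2 e he.1 e' he'.1 (Or.inr (he.2.trans he'.2.symm))
  have hsub : T i ⊆ insert (f i) (C (i + 1) ∪ N) := by
    intro v hv
    rw [memT] at hv
    rw [Finset.mem_insert, Finset.mem_union]
    rcases hv with h | h | h
    · exact Or.inl h
    · have hcase : ∀ e ∈ M i, e.2 = f i ∨ e ∈ M (i + 1) := by
        intro e he
        by_cases h2 : e.2 = f i
        · exact Or.inl h2
        · refine Or.inr ((hM i).2.2 e he ?_)
          have h3 := ((hM i).1.1 e he).2.1
          rw [memA] at h3 ⊢
          have h4 : r e.2 ≠ r (f i) := fun h => h2 (r_inj _ _ h)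
          rw [r_f] at h4
          omega
      rw [memC] at h
      rcases h with ⟨e, he, rfl⟩ | ⟨e, he, rfl⟩
      · rcases hcase e he with h | h
        · exact Or.inr (Or.inr (Finset.mem_image.2 ⟨e, Finset.mem_filter.2 ⟨he, h⟩, rfl⟩))
        · exact Or.inr (Or.inl ((memC _ _).2 (Or.inl ⟨e, h, rfl⟩)))
      · rcases hcase e he with h | h
        · exact Or.inl h
        · exact Or.inr (Or.inl ((memC _ _).2 (Or.inr ⟨e, h, rfl⟩)))
    · exact Or.inr (Or.inl h)
  have h1 := Finset.card_le_card hsub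
  have h2 := Finset.card_insert_le (f i) (C (i + 1) ∪ N)
  have h3 := Finset.card_union_le (C (i + 1)) N
  have h4 : (C (i + 1)).card ≤ _ := Finset.card_union_le _ _
  have h5 : ((M (i + 1)).image Prod.fst).card ≤ _ := Finset.card_image_le
  have h6 : ((M (i + 1)).image Prod.snd).card ≤ _ := Finset.card_image_le
  change (T i).card ≤ _
  omega

/-! ### Counting vertex assignments that avoid a pattern on each edge of a matching -/

/-- Distinct members of `M` share no vertex. -/
def PairwiseVertexDisjoint {V : Type} (M : Finset (V × V)) : Prop :=
  ∀ e ∈ M, ∀ f ∈ M, e ≠ f → e.1 ≠ f.1 ∧ e.1 ≠ f.2 ∧ e.2 ≠ f.1 ∧ e.2 ≠ f.2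

theorem card_avoiding_pattern_le {V : Type} [Fintype V] [DecidableEq V]
    (pat : V × V → Bool × Bool) (M : Finset (V × V)) (hne : ∀ e ∈ M, e.1 ≠ e.2)
    (hM : PairwiseVertexDisjoint M) :
    4 ^ M.card * (Finset.univ.filter fun τ : V → Bool =>
        ∀ e ∈ M, (τ e.1, τ e.2) ≠ pat e).card ≤
      3 ^ M.card * Fintype.card (V → Bool) := by
  induction M using Finset.induction_on with
  | empty => simp
  | insert a M ha ih =>
    have ih := ih (fun e he => hne e (Finset.mem_insert_of_mem he))
      (fun e he f hf => hM e (Finset.mem_insert_of_mem he) f (Finset.mem_insert_of_mem hf))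
    set F := Finset.univ.filter fun τ : V → Bool => ∀ e ∈ M, (τ e.1, τ e.2) ≠ pat e with hF
    have hsplit : (F.filter fun τ => (τ a.1, τ a.2) = pat a).card +
        (F.filter fun τ => ¬ (τ a.1, τ a.2) = pat a).card = F.card :=
      Finset.card_filter_add_card_filter_not _
    have heq : (Finset.univ.filter fun τ : V → Bool =>
        ∀ e ∈ insert a M, (τ e.1, τ e.2) ≠ pat e) =
        F.filter fun τ => ¬ (τ a.1, τ a.2) = pat a := by
      ext τ
      simp only [hF, Finset.mem_filter, Finset.mem_univ, true_and, Finset.forall_mem_insert]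
      tauto
    have ha12 : a.1 ≠ a.2 := hne a (Finset.mem_insert_self _ _)
    have hbad : F.card ≤ 4 * (F.filter fun τ => (τ a.1, τ a.2) = pat a).card := by
      let φ : (V → Bool) → V → Bool := fun τ =>
        Function.update (Function.update τ a.1 (pat a).1) a.2 (pat a).2
      have hφ : ∀ τ w, w ≠ a.1 → w ≠ a.2 → φ τ w = τ w := by
        intro τ w h1 h2
        simp [φ, h1, h2]
      refine Finset.card_le_mul_card_image_of_maps_to (f := φ) (fun τ hτ => ?_) 4 (fun ρ _ => ?_)
      · rw [Finset.mem_filter]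
        refine ⟨?_, by simp [φ, ha12]⟩
        rw [hF, Finset.mem_filter] at hτ
        rw [hF, Finset.mem_filter]
        refine ⟨Finset.mem_univ _, fun e he => ?_⟩
        obtain ⟨h1, h2, h3, h4⟩ := hM e (Finset.mem_insert_of_mem he) a
          (Finset.mem_insert_self _ _) (fun h => ha (h ▸ he))
        rw [hφ τ _ h1 h2, hφ τ _ h3 h4]
        exact hτ.2 e he
      · have h4 : (Finset.univ : Finset (Bool × Bool)).card = 4 := rfl
        rw [← h4]
        refine Finset.card_le_card_of_injOn (fun τ => (τ a.1, τ a.2))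
          (fun _ _ => Finset.mem_coe.2 (Finset.mem_univ _)) ?_
        intro τ hτ τ' hτ' h
        rw [Finset.mem_coe, Finset.mem_filter] at hτ hτ'
        simp only [Prod.mk.injEq] at h
        funext w
        by_cases h1 : w = a.1
        · rw [h1, h.1]
        by_cases h2 : w = a.2
        · rw [h2, h.2]
        rw [← hφ τ w h1 h2, ← hφ τ' w h1 h2, hτ.2, hτ'.2]
    rw [heq, Finset.card_insert_of_notMem ha, pow_succ, pow_succ]
    have hle : 4 * (F.filter fun τ => ¬ (τ a.1, τ a.2) = pat a).card ≤ 3 * F.card := by omega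
    calc 4 ^ M.card * 4 * _ = 4 ^ M.card * (4 * _) := by ring
      _ ≤ 4 ^ M.card * (3 * F.card) := Nat.mul_le_mul_left _ hle
      _ = 3 * (4 ^ M.card * F.card) := by ring
      _ ≤ 3 * (3 ^ M.card * _) := Nat.mul_le_mul_left _ ih
      _ = _ := by ring

/-! ### Paths of branching programs -/

namespace BP

variable {X : Type}

theorem isPathFrom_append (Z : BP X) {u v : Fin Z.n} {p q : List (Fin Z.m)} :
    Z.IsPathFrom u v (p ++ q) ↔ ∃ w, Z.IsPathFrom u w p ∧ Z.IsPathFrom w v q := by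
  induction p generalizing u with
  | nil => simp [IsPathFrom]
  | cons e p ih => simp [IsPathFrom, ih, and_assoc]

theorem IsPathFrom.append {Z : BP X} {u v w : Fin Z.n} {p q : List (Fin Z.m)}
    (hp : Z.IsPathFrom u w p) (hq : Z.IsPathFrom w v q) : Z.IsPathFrom u v (p ++ q) :=
  Z.isPathFrom_append.2 ⟨w, hp, hq⟩

theorem IsPathFrom.end_unique {Z : BP X} {u v w : Fin Z.n} {p : List (Fin Z.m)}
    (hv : Z.IsPathFrom u v p) (hw : Z.IsPathFrom u w p) : v = w := by
  induction p generalizing u with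
  | nil => exact hv.symm.trans hw
  | cons e p ih => exact ih hv.2 hw.2

/-- Some edge of `p` is labelled with a literal of `x`. -/
def Occurs (Z : BP X) (p : List (Fin Z.m)) (x : X) : Prop :=
  ∃ e ∈ p, (Z.label e).map Prod.fst = some x

/-- The variable `x` occurs on some path from `a` to `b`. -/
def OccursBetween (Z : BP X) (a b : Fin Z.n) (x : X) : Prop :=
  ∃ p, Z.IsPathFrom a b p ∧ Z.Occurs p x

/-- Every path from `a` to `c` is read-once. -/
def ReadOnceBetween [DecidableEq X] (Z : BP X) (a c : Fin Z.n) : Prop :=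
  ∀ p, Z.IsPathFrom a c p → Z.ReadOnce p

theorem occurs_append (Z : BP X) {p q : List (Fin Z.m)} {x : X} :
    Z.Occurs (p ++ q) x ↔ Z.Occurs p x ∨ Z.Occurs q x := by
  simp only [Occurs, List.mem_append, or_and_right, exists_or]

theorem Occurs.varCount_pos [DecidableEq X] {Z : BP X} {p : List (Fin Z.m)} {x : X}
    (h : Z.Occurs p x) : 0 < Z.varCount p x := by
  obtain ⟨e, he, hx⟩ := h
  refine List.countP_pos_iff.2 ⟨e, he, ?_⟩
  obtain ⟨l, hl, rfl⟩ := Option.map_eq_some_iff.1 hx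
  simp [hl]

theorem ReadOnceBetween.disjoint [DecidableEq X] {Z : BP X} {a b c : Fin Z.n}
    (h : Z.ReadOnceBetween a c) {x : X} (h₁ : Z.OccursBetween a b x)
    (h₂ : Z.OccursBetween b c x) : False := by
  obtain ⟨p, hp, hpx⟩ := h₁
  obtain ⟨q, hq, hqx⟩ := h₂
  have h1 := h _ (hp.append hq) x
  have h2 := hpx.varCount_pos
  have h3 := hqx.varCount_pos
  rw [varCount, List.countP_append] at h1
  rw [varCount] at h2 h3
  omega

theorem ReadOnce.of_sublist [DecidableEq X] {Z : BP X} {p q : List (Fin Z.m)}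
    (h : Z.ReadOnce q) (hpq : p.Sublist q) : Z.ReadOnce p :=
  fun x => (hpq.countP_le).trans (h x)

theorem Acyclic.not_occursBetween_self {Z : BP X} (h : Z.Acyclic) (a : Fin Z.n) (x : X) :
    ¬ Z.OccursBetween a a x := by
  rintro ⟨p, hp, e, he, -⟩
  rw [h a p hp] at he
  exact List.not_mem_nil he

theorem Acyclic.readOnceBetween_self [DecidableEq X] {Z : BP X} (h : Z.Acyclic)
    (a : Fin Z.n) : Z.ReadOnceBetween a a := by
  intro p hp x
  simp [h a p hp, varCount]

theorem exists_maximal_readOnceBetween_prefix [DecidableEq X] (Z : BP X) {a t : Fin Z.n}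
    (hbad : ¬ Z.ReadOnceBetween a t) (q : List (Fin Z.m)) :
    ∀ (p : List (Fin Z.m)) (c : Fin Z.n), Z.IsPathFrom a c p → Z.IsPathFrom c t q →
      Z.ReadOnceBetween a c →
      ∃ p' e q', p ++ q = p' ++ e :: q' ∧ Z.IsPathFrom a (Z.esrc e) p' ∧
        Z.ReadOnceBetween a (Z.esrc e) ∧ ¬ Z.ReadOnceBetween a (Z.edst e) ∧
        Z.IsPathFrom (Z.edst e) t q' := by
  induction q with
  | nil =>
    intro p c _ hq hc
    exact absurd ((show c = t from hq) ▸ hc) hbad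
  | cons e q ih =>
    intro p c hp hq hc
    obtain ⟨rfl, hq⟩ := hq
    by_cases he : Z.ReadOnceBetween a (Z.edst e)
    · have := ih (p ++ [e]) (Z.edst e) (hp.append ⟨rfl, rfl⟩) hq he
      rwa [List.append_assoc, List.singleton_append] at this
    · exact ⟨p, e, q, rfl, hp, hc, he, hq⟩

/-- Removing a prefix which is not read-once from a separable path leaves a path that can be
partitioned into one read-once subpath less. -/
theorem exists_partition_of_append [DecidableEq X] (Z : BP X) {p q : List (Fin Z.m)} {d : ℕ}
    (hp : ¬ Z.ReadOnce p)
    (h : ∃ ps : List (List (Fin Z.m)), ps.length ≤ d + 1 ∧ ps.flatten = p ++ q ∧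
      ∀ s ∈ ps, Z.ReadOnce s) :
    ∃ ps : List (List (Fin Z.m)), ps.length ≤ d ∧ ps.flatten = q ∧
      ∀ s ∈ ps, Z.ReadOnce s := by
  have drop : ∀ (ps : List (List (Fin Z.m))) (l : List (Fin Z.m)), (∀ s ∈ ps, Z.ReadOnce s) →
      ps.flatten = l ++ q → ∃ ps' : List (List (Fin Z.m)), ps'.length ≤ ps.length ∧
        ps'.flatten = q ∧ ∀ s ∈ ps', Z.ReadOnce s := by
    intro ps
    induction ps with
    | nil =>
      intro l _ hl
      have : q = [] := (List.append_eq_nil_iff.1 hl.symm).2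
      exact ⟨[], le_rfl, this.symm, by simp⟩
    | cons s ps ih =>
      intro l hs hl
      rw [List.flatten_cons] at hl
      rcases List.append_eq_append_iff.1 hl with ⟨a, rfl, h2⟩ | ⟨a, rfl, h2⟩
      · obtain ⟨ps', h3, h4, h5⟩ := ih a (fun s hs' => hs s (List.mem_cons_of_mem _ hs')) h2
        exact ⟨ps', h3.trans (Nat.le_succ _), h4, h5⟩
      · refine ⟨a :: ps, le_rfl, by rw [List.flatten_cons, h2], fun s' hs' => ?_⟩
        rcases List.mem_cons.1 hs' with rfl | hs'
        · exact (hs _ List.mem_cons_self).of_sublist (List.sublist_append_right _ _)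
        · exact hs _ (List.mem_cons_of_mem _ hs')
  obtain ⟨ps, hlen, hflat, hro⟩ := h
  cases ps with
  | nil =>
    have : p = [] := (List.append_eq_nil_iff.1 hflat.symm).1
    exact absurd (fun x => by simp [this, varCount]) hp
  | cons s ps =>
    rw [List.flatten_cons] at hflat
    rcases List.append_eq_append_iff.1 hflat with ⟨a, rfl, h2⟩ | ⟨a, rfl, h2⟩
    · obtain ⟨ps', h3, h4, h5⟩ := drop ps a (fun s hs' => hro s (List.mem_cons_of_mem _ hs')) h2
      refine ⟨ps', h3.trans ?_, h4, h5⟩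
      rw [List.length_cons] at hlen
      omega
    · exact absurd ((hro _ List.mem_cons_self).of_sublist (List.sublist_append_left _ _)) hp

theorem IsNBP.card_vertices_le {Z : BP X} (h : Z.IsNBP) : Z.n ≤ Z.m + 1 := by
  have hin : ∀ v, v ≠ Z.source → ∃ e, Z.edst e = v := by
    intro v hv
    obtain ⟨p, hp⟩ := (h.2.2.2 v).1
    rcases List.eq_nil_or_concat p with rfl | ⟨q, e, rfl⟩
    · exact absurd hp.symm hv
    · rw [List.concat_eq_append] at hp
      obtain ⟨w, -, -, he⟩ := Z.isPathFrom_append.1 hp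
      exact ⟨e, he⟩
  let φ : Option (Fin Z.m) → Fin Z.n := fun o => o.elim Z.source Z.edst
  have hφ : Function.Surjective φ := by
    intro v
    by_cases hv : v = Z.source
    · exact ⟨none, hv.symm⟩
    · obtain ⟨e, he⟩ := hin v hv
      exact ⟨some e, he⟩
  simpa using Fintype.card_le_of_surjective φ hφ

end BP

/-! ### Clauses hit by all paths between two nodes -/

/-- The variable `x` occurs in the clause of the edge `{u, v}`. -/
def InClause {V : Type} (u v : V) (x : PsiVar V) : Prop :=
  x = Sum.inl u ∨ x = Sum.inr s(u, v) ∨ x = Sum.inl v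

theorem InClause.symm {V : Type} {u v : V} {x : PsiVar V} (h : InClause u v x) :
    InClause v u x := by
  unfold InClause at *
  rw [Sym2.eq_swap]
  tauto

/-- Every path from `a` to `c` contains a variable of the clause of `{u, v}`. -/
def HitByAll {V : Type} (Z : BP (PsiVar V)) (a c : Fin Z.n) (u v : V) : Prop :=
  ∀ p, Z.IsPathFrom a c p → ∃ x, InClause u v x ∧ Z.Occurs p x

theorem HitByAll.symm {V : Type} {Z : BP (PsiVar V)} {a c : Fin Z.n} {u v : V}
    (h : HitByAll Z a c u v) : HitByAll Z a c v u := fun p hp =>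
  let ⟨x, hx, hpx⟩ := h p hp
  ⟨x, hx.symm, hpx⟩

theorem HitByAll.split {V : Type} {Z : BP (PsiVar V)} {a c : Fin Z.n} {u v : V}
    (h : HitByAll Z a c u v) (b : Fin Z.n) : HitByAll Z a b u v ∨ HitByAll Z b c u v := by
  by_contra hcon
  simp only [HitByAll, not_or, not_forall] at hcon
  obtain ⟨⟨p, hp, h1⟩, ⟨q, hq, h2⟩⟩ := hcon
  obtain ⟨x, hx, hpx⟩ := h _ (hp.append hq)
  rcases Z.occurs_append.1 hpx with h | h
  · exact h1 ⟨x, hx, h⟩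
  · exact h2 ⟨x, hx, h⟩

/-- The clause of `{u, v}` is hit by all paths from `a` to `c`, but neither the paths from `a`
to `b` nor the paths from `b` to `c` contain all of its variables. -/
def IsSplit {V : Type} (G : SimpleGraph V) (Z : BP (PsiVar V)) (a b c : Fin Z.n)
    (u v : V) : Prop :=
  G.Adj u v ∧ HitByAll Z a c u v ∧ (∃ x, InClause u v x ∧ ¬ Z.OccursBetween a b x) ∧
    ∃ x, InClause u v x ∧ ¬ Z.OccursBetween b c x

/-- The graph of the edges whose clause is hit by all paths from `a` to `c` or contains the
variable `o`. -/
def segmentGraph {V : Type} (G : SimpleGraph V) (Z : BP (PsiVar V)) (a c : Fin Z.n)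
    (o : Option (PsiVar V)) : SimpleGraph V where
  Adj u v := G.Adj u v ∧ (HitByAll Z a c u v ∨ ∃ x, InClause u v x ∧ o = some x)
  symm := ⟨by
    rintro u v ⟨h, h' | ⟨x, hx, ho⟩⟩
    · exact ⟨h.symm, Or.inl h'.symm⟩
    · exact ⟨h.symm, Or.inr ⟨x, hx.symm, ho⟩⟩⟩
  loopless := ⟨fun u h => G.loopless.irrefl u h.1⟩

theorem segmentGraph_le {V : Type} (G : SimpleGraph V) (Z : BP (PsiVar V)) (a c : Fin Z.n)
    (o : Option (PsiVar V)) : segmentGraph G Z a c o ≤ G :=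
  fun _ _ h => h.1

theorem IsCutMatching.eq_of_inClause {V : Type} {H : SimpleGraph V} {A : Finset V}
    {M : Finset (V × V)} (hM : IsCutMatching H A M) {e f : V × V} (he : e ∈ M) (hf : f ∈ M)
    {x : PsiVar V} (hex : InClause e.1 e.2 x) (hfx : InClause f.1 f.2 x) : e = f := by
  obtain ⟨he1, he2, -⟩ := hM.1 e he
  obtain ⟨hf1, hf2, -⟩ := hM.1 f hf
  apply hM.2 e he f hf
  have hne : e.1 ≠ f.2 := fun h => hf2 (h ▸ he1)
  have hne' : f.1 ≠ e.2 := fun h => he2 (h ▸ hf1)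
  rcases hex with rfl | rfl | rfl <;> rcases hfx with h | h | h <;>
    simp only [Sum.inl.injEq, Sum.inr.injEq, reduceCtorEq, Sym2.eq_iff] at h <;> grind

theorem IsCutMatching.pairwiseVertexDisjoint {V : Type} {H : SimpleGraph V} {A : Finset V}
    {M : Finset (V × V)} (hM : IsCutMatching H A M) : PairwiseVertexDisjoint M := by
  intro e he f hf hef
  obtain ⟨he1, he2, -⟩ := hM.1 e he
  obtain ⟨hf1, hf2, -⟩ := hM.1 f hf
  exact ⟨fun h => hef (hM.2 e he f hf (Or.inl h)), fun h => hf2 (h ▸ he1),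
    fun h => he2 (h ▸ hf1), fun h => hef (hM.2 e he f hf (Or.inr h))⟩

theorem pathwidth_segmentGraph_le {V : Type} [Fintype V] [DecidableEq V] (G : SimpleGraph V)
    (Z : BP (PsiVar V)) (hZ : Z.Acyclic) {a c : Fin Z.n} (hac : Z.ReadOnceBetween a c)
    {p : List (Fin Z.m)} (hp : Z.IsPathFrom a c p) (r : ℕ)
    (hr : ∀ b p₁ p₂, p₁ ++ p₂ = p → Z.IsPathFrom a b p₁ → Z.IsPathFrom b c p₂ →
      ∀ M : Finset (V × V), PairwiseVertexDisjoint M →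
        (∀ e ∈ M, IsSplit G Z a b c e.1 e.2) → M.card ≠ r + 1)
    (o : Option (PsiVar V)) : pathwidth (segmentGraph G Z a c o) ≤ 4 * r + 5 := by
  classical
  have hnode : ∀ j, ∃ b, Z.IsPathFrom a b (p.take j) ∧ Z.IsPathFrom b c (p.drop j) := fun j =>
    Z.isPathFrom_append.1 (by rwa [List.take_append_drop])
  choose b hb₁ hb₂ using hnode
  have hstep : ∀ j, Z.IsPathFrom (b j) (b (j + 1)) ((p.drop j).take 1) := by
    intro j
    have h := hb₁ (j + 1)
    rw [List.take_add] at h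
    obtain ⟨w, hw₁, hw₂⟩ := Z.isPathFrom_append.1 h
    rwa [(hb₁ j).end_unique hw₁]
  have hb0 : b 0 = a := ((hb₁ 0).end_unique (by simp [BP.IsPathFrom]))
  have hblast : ∀ j, p.length ≤ j → b j = c := fun j hj => by
    have := hb₂ j
    rwa [List.drop_eq_nil_of_le hj] at this
  have hmono : ∀ j x, Z.OccursBetween a (b j) x → Z.OccursBetween a (b (j + 1)) x := by
    rintro j x ⟨q, hq, hx⟩
    exact ⟨_, hq.append (hstep j), Z.occurs_append.2 (Or.inl hx)⟩
  have hmono_le : ∀ i j x, i ≤ j → Z.OccursBetween a (b i) x → Z.OccursBetween a (b j) x := by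
    intro i j x hij
    induction j, hij using Nat.le_induction with
    | base => exact id
    | succ j _ ih => exact fun h => hmono j x (ih h)
  have hex : ∀ v : V, ∃ j, p.length < j ∨ Z.OccursBetween a (b j) (Sum.inl v) :=
    fun _ => ⟨p.length + 1, Or.inl (Nat.lt_succ_self _)⟩
  have hsmall : ∀ t (M : Finset (V × V)), PairwiseVertexDisjoint M →
      (∀ e ∈ M, IsSplit G Z a (b t) c e.1 e.2) → M.card ≤ r := by
    intro t M hM hsp
    by_contra hcon
    obtain ⟨M', hM', hcard⟩ := Finset.exists_subset_card_eq (show r + 1 ≤ M.card by omega)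
    exact hr (b t) _ _ (List.take_append_drop t p) (hb₁ t) (hb₂ t) M'
      (fun e he f hf => hM e (hM' he) f (hM' hf)) (fun e he => hsp e (hM' he)) hcard
  have hwidth := pathwidth_le_of_cutMatching_card_le (segmentGraph G Z a c o) (2 * r + 2)
    (fun v => Nat.find (hex v)) ?_
  · omega
  intro A j hlow hhigh M hM
  cases j with
  | zero =>
    have : M = ∅ := by
      rw [Finset.eq_empty_iff_forall_notMem]
      intro e he
      have h0 := (Nat.find_eq_zero (hex e.1)).1 (Nat.le_zero.1 (hhigh e.1 (hM.1 e he).1))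
      rcases h0 with h0 | h0
      · omega
      · rw [hb0] at h0
        exact hZ.not_occursBetween_self _ _ h0
    simp [this]
  | succ t =>
    have hin : ∀ v ∈ A, t < p.length → Z.OccursBetween a (b (t + 1)) (Sum.inl v) := by
      intro v hv ht
      have hle := hhigh v hv
      rcases Nat.find_spec (hex v) with h | h
      · omega
      · exact hmono_le _ _ _ hle h
    have hout : ∀ v ∉ A, ¬ Z.OccursBetween a (b t) (Sum.inl v) := by
      intro v hv h
      exact hv (hlow v (Nat.lt_succ_of_le (Nat.find_min' (hex v) (Or.inr h))))
    obtain ⟨o', ho'⟩ : ∃ o' : Option (PsiVar V), ∀ x, Z.Occurs ((p.drop t).take 1) x →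
        o' = some x := by
      cases p.drop t with
      | nil => exact ⟨none, fun x hx => by simp [BP.Occurs] at hx⟩
      | cons e l => exact ⟨(Z.label e).map Prod.fst, fun x hx => by simpa [BP.Occurs] using hx⟩
    have hcases : ∀ e ∈ M, IsSplit G Z a (b t) c e.1 e.2 ∨ IsSplit G Z a (b (t + 1)) c e.1 e.2 ∨
        (∃ x, InClause e.1 e.2 x ∧ o = some x) ∨ ∃ x, InClause e.1 e.2 x ∧ o' = some x := by
      intro e he
      obtain ⟨he1, he2, hG, hhit | hhit⟩ := hM.1 e he
      · have hnot := hout _ he2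
        by_cases hs : ∃ x, InClause e.1 e.2 x ∧ ¬ Z.OccursBetween (b t) c x
        · exact Or.inl ⟨hG, hhit, ⟨_, Or.inr (Or.inr rfl), hnot⟩, hs⟩
        push Not at hs
        have ht : t < p.length := by
          by_contra ht
          have := hs _ (Or.inl rfl)
          rw [hblast t (by omega)] at this
          exact hZ.not_occursBetween_self _ _ this
        by_cases hs' : ∃ x, InClause e.1 e.2 x ∧ ¬ Z.OccursBetween a (b (t + 1)) x
        · exact Or.inr (Or.inl ⟨hG, hhit, hs', ⟨_, Or.inl rfl,
            fun h => hac.disjoint (hin _ he1 ht) h⟩⟩)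
        push Not at hs'
        obtain ⟨x, hx, hpx⟩ := hhit p hp
        rw [← List.take_append_drop (t + 1) p, List.take_add, Z.occurs_append,
          Z.occurs_append] at hpx
        rcases hpx with (h | h) | h
        · exact absurd (hs x hx) fun h' => hac.disjoint ⟨_, hb₁ t, h⟩ h'
        · exact Or.inr (Or.inr (Or.inr ⟨x, hx, ho' x h⟩))
        · exact absurd (hs' x hx) fun h' => hac.disjoint h' ⟨_, hb₂ (t + 1), h⟩
      · exact Or.inr (Or.inr (Or.inl hhit))
    have hone : ∀ o : Option (PsiVar V),
        (M.filter fun e => ∃ x, InClause e.1 e.2 x ∧ o = some x).card ≤ 1 := by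
      intro o
      refine Finset.card_le_one.2 fun e he f hf => ?_
      rw [Finset.mem_filter] at he hf
      obtain ⟨he, x, hx, rfl⟩ := he
      obtain ⟨hf, y, hy, hxy⟩ := hf
      obtain rfl := Option.some.inj hxy
      exact hM.eq_of_inClause he hf hx hy
    have hfew : ∀ s, (M.filter fun e => IsSplit G Z a (b s) c e.1 e.2).card ≤ r := fun s =>
      hsmall s _ (fun e he f hf => hM.pairwiseVertexDisjoint e (Finset.mem_filter.1 he).1 f
        (Finset.mem_filter.1 hf).1) (fun e he => (Finset.mem_filter.1 he).2)
    have hsub : M ⊆ ((M.filter fun e => IsSplit G Z a (b t) c e.1 e.2) ∪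
        (M.filter fun e => IsSplit G Z a (b (t + 1)) c e.1 e.2)) ∪
        ((M.filter fun e => ∃ x, InClause e.1 e.2 x ∧ o = some x) ∪
        (M.filter fun e => ∃ x, InClause e.1 e.2 x ∧ o' = some x)) := by
      intro e he
      simpa only [Finset.mem_union, Finset.mem_filter, he, true_and, or_assoc] using hcases e he
    have h1 := Finset.card_le_card hsub
    have h2 := Finset.card_union_le ((M.filter fun e => IsSplit G Z a (b t) c e.1 e.2) ∪
        (M.filter fun e => IsSplit G Z a (b (t + 1)) c e.1 e.2))
        ((M.filter fun e => ∃ x, InClause e.1 e.2 x ∧ o = some x) ∪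
        (M.filter fun e => ∃ x, InClause e.1 e.2 x ∧ o' = some x))
    have h3 := Finset.card_union_le (M.filter fun e => IsSplit G Z a (b t) c e.1 e.2)
        (M.filter fun e => IsSplit G Z a (b (t + 1)) c e.1 e.2)
    have h4 := Finset.card_union_le (M.filter fun e => ∃ x, InClause e.1 e.2 x ∧ o = some x)
        (M.filter fun e => ∃ x, InClause e.1 e.2 x ∧ o' = some x)
    have h5 := hone o
    have h6 := hone o'
    have h7 := hfew t
    have h8 := hfew (t + 1)
    omega

theorem exists_segmentGraph_cover {V : Type} [DecidableEq V] (G : SimpleGraph V)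
    (Z : BP (PsiVar V)) (hZ : Z.Acyclic) (t : Fin Z.n) (w d : ℕ) :
    ∀ (a : Fin Z.n) (p : List (Fin Z.m)), Z.IsPathFrom a t p →
      (∀ q, Z.IsPathFrom a t q → ∃ ps : List (List (Fin Z.m)),
        ps.length ≤ d ∧ ps.flatten = q ∧ ∀ s ∈ ps, Z.ReadOnce s) →
      (∀ a' c p' o, p' ⊆ p → Z.IsPathFrom a' c p' → Z.ReadOnceBetween a' c →
        pathwidth (segmentGraph G Z a' c o) ≤ w) →
      ∃ f : Fin d → SimpleGraph V, (∀ i, f i ≤ G) ∧ (∀ i, pathwidth (f i) ≤ w) ∧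
        ∀ u v, G.Adj u v → HitByAll Z a t u v → ∃ i, (f i).Adj u v := by
  induction d with
  | zero =>
    intro a p hp hsep _
    refine ⟨fun _ => ⊥, fun i => i.elim0, fun i => i.elim0, fun u v _ hhit => ?_⟩
    obtain ⟨ps, h1, h2, -⟩ := hsep p hp
    rw [List.length_eq_zero_iff.1 (Nat.le_zero.1 h1), List.flatten_nil] at h2
    obtain ⟨x, -, e, he, -⟩ := hhit p hp
    rw [← h2] at he
    exact absurd he List.not_mem_nil
  | succ d ih =>
    intro a p hp hsep hw
    by_cases hgood : Z.ReadOnceBetween a t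
    · exact ⟨fun _ => segmentGraph G Z a t none, fun _ => segmentGraph_le _ _ _ _ _,
        fun _ => hw a t p none (List.Subset.refl p) hp hgood,
        fun u v huv hhit => ⟨0, huv, Or.inl hhit⟩⟩
    · obtain ⟨p₁, e, p₂, hpe, hp₁, hro, hbad, hp₂⟩ :=
        Z.exists_maximal_readOnceBetween_prefix hgood p [] a rfl hp (hZ.readOnceBetween_self a)
      rw [List.nil_append] at hpe
      have hbad' : ∃ q, Z.IsPathFrom a (Z.edst e) q ∧ ¬ Z.ReadOnce q := by
        simpa only [BP.ReadOnceBetween, not_forall, exists_prop] using hbad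
      obtain ⟨q, hq, hqbad⟩ := hbad'
      obtain ⟨f, hf₁, hf₂, hf₃⟩ := ih (Z.edst e) p₂ hp₂
        (fun s hs => Z.exists_partition_of_append hqbad (hsep _ (hq.append hs)))
        (fun a' c p' o hp' => hw a' c p' o fun x hx => by
          rw [hpe]
          exact List.mem_append_right _ (List.mem_cons_of_mem _ (hp' hx)))
      have hfst : pathwidth (segmentGraph G Z a (Z.esrc e) ((Z.label e).map Prod.fst)) ≤ w :=
        hw a _ p₁ _ (fun x hx => hpe ▸ List.mem_append_left _ hx) hp₁ hro
      refine ⟨Fin.cons (segmentGraph G Z a (Z.esrc e) ((Z.label e).map Prod.fst)) f,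
        fun i => i.cases (segmentGraph_le _ _ _ _ _) hf₁, fun i => i.cases hfst hf₂,
        fun u v huv hhit => ?_⟩
      rcases hhit.split (Z.esrc e) with h | h
      · exact ⟨0, huv, Or.inl h⟩
      · rcases h.split (Z.edst e) with h | h
        · obtain ⟨x, hx, hxe⟩ := h [e] ⟨rfl, rfl⟩
          exact ⟨0, huv, Or.inr ⟨x, hx, by simpa [BP.Occurs] using hxe⟩⟩
        · obtain ⟨i, hi⟩ := hf₃ u v huv h
          exact ⟨i.succ, hi⟩

/-! ### The lower bound -/

/-- The assignment extending `τ` in which an edge variable is true exactly when both endpoints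
of the edge are false. -/
def edgeCompletion {V : Type} [Fintype V] [DecidableEq V] (τ : V → Bool) : Assignment V :=
  Sum.elim τ fun e => decide (∀ w ∈ e, τ w = false)

theorem psiSat_edgeCompletion {V : Type} [Fintype V] [DecidableEq V] (G : SimpleGraph V)
    (τ : V → Bool) : psiSat G (edgeCompletion τ) := by
  intro u v _
  cases hu : τ u <;> cases hv : τ v <;> simp [edgeCompletion, hu, hv]

theorem exists_avoided_pattern {V : Type} [Fintype V] [DecidableEq V] {u v : V} {y : PsiVar V}
    (hy : InClause u v y) :
    ∃ b : Bool × Bool, ∀ τ : V → Bool,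
      (∃ x, InClause u v x ∧ x ≠ y ∧ edgeCompletion τ x = true) → (τ u, τ v) ≠ b := by
  rcases hy with rfl | rfl | rfl
  · refine ⟨(true, false), ?_⟩
    rintro τ ⟨x, rfl | rfl | rfl, hne, hx⟩ h <;> simp_all [edgeCompletion]
  · refine ⟨(false, false), ?_⟩
    rintro τ ⟨x, rfl | rfl | rfl, hne, hx⟩ h <;> simp_all [edgeCompletion]
  · refine ⟨(false, true), ?_⟩
    rintro τ ⟨x, rfl | rfl | rfl, hne, hx⟩ h <;> simp_all [edgeCompletion]

theorem IsSplit.exists_avoided_pattern {V : Type} [Fintype V] [DecidableEq V]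
    {G : SimpleGraph V} {Z : BP (PsiVar V)} {a b c : Fin Z.n} {u v : V}
    (h : IsSplit G Z a b c u v) :
    ∃ β : Bool × Bool, ∀ τ : V → Bool,
      (∃ p q, Z.IsPathFrom a b p ∧ Z.IsPathFrom b c q ∧
        ∀ x, Z.Occurs p x ∨ Z.Occurs q x → edgeCompletion τ x = true) → (τ u, τ v) ≠ β := by
  obtain ⟨-, hhit, ⟨y, hy, hya⟩, ⟨z, hz, hzc⟩⟩ := h
  rcases hhit.split b with h | h
  · obtain ⟨β, hβ⟩ := _root_.exists_avoided_pattern hy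
    refine ⟨β, fun τ ⟨p, q, hp, _, hτ⟩ => hβ τ ?_⟩
    obtain ⟨x, hx, hpx⟩ := h p hp
    exact ⟨x, hx, fun hxy => hya (hxy ▸ ⟨p, hp, hpx⟩), hτ x (Or.inl hpx)⟩
  · obtain ⟨β, hβ⟩ := _root_.exists_avoided_pattern hz
    refine ⟨β, fun τ ⟨p, q, _, hq, hτ⟩ => hβ τ ?_⟩
    obtain ⟨x, hx, hqx⟩ := h q hq
    exact ⟨x, hx, fun hxy => hzc (hxy ▸ ⟨q, hq, hqx⟩), hτ x (Or.inr hqx)⟩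

theorem hitByAll_source_sink {V : Type} [DecidableEq V] {G : SimpleGraph V}
    {Z : BP (PsiVar V)} (hmon : Z.MonotoneBP) (hrep : RepresentsPsi G Z) {u v : V}
    (huv : G.Adj u v) : HitByAll Z Z.source Z.sink u v := by
  classical
  intro p hp
  have hsat : Z.Sat fun x => decide (Z.Occurs p x) := by
    refine ⟨p, hp, fun e he l hl => ?_⟩
    rw [hmon e l hl, decide_eq_true_eq]
    exact ⟨e, he, by rw [hl]; rfl⟩
  have := (hrep _).1 hsat huv
  simp only [decide_eq_true_eq] at this
  rcases this with h | h | h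
  · exact ⟨_, Or.inl rfl, h⟩
  · exact ⟨_, Or.inr (Or.inl rfl), h⟩
  · exact ⟨_, Or.inr (Or.inr rfl), h⟩

/-- Every assignment of the vertices is carried by a path through three nodes which split the
clauses of a large matching. -/
theorem exists_split_matching {V : Type} [Fintype V] [DecidableEq V] {G : SimpleGraph V}
    {d r : ℕ} {Z : BP (PsiVar V)} (hG : 4 * r + 5 < dPathwidth d G) (hZ : Z.IsSMNBP d)
    (hrep : RepresentsPsi G Z) (τ : V → Bool) :
    ∃ a b c, (∃ M : Finset (V × V), PairwiseVertexDisjoint M ∧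
        (∀ e ∈ M, IsSplit G Z a b c e.1 e.2) ∧ M.card = r + 1) ∧
      ∃ p q, Z.IsPathFrom a b p ∧ Z.IsPathFrom b c q ∧
        ∀ x, Z.Occurs p x ∨ Z.Occurs q x → edgeCompletion τ x = true := by
  obtain ⟨hnbp, hmon, -, hsep⟩ := hZ
  by_contra hcon
  obtain ⟨P, hP, hagree⟩ := (hrep _).2 (psiSat_edgeCompletion G τ)
  have htrue : ∀ q, q ⊆ P → ∀ x, Z.Occurs q x → edgeCompletion τ x = true := by
    rintro q hq x ⟨e, he, hx⟩
    obtain ⟨l, hl, rfl⟩ := Option.map_eq_some_iff.1 hx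
    rw [hagree e (hq he) l hl, hmon e l hl]
  obtain ⟨f, hf₁, hf₂, hf₃⟩ := exists_segmentGraph_cover G Z hnbp.1 Z.sink (4 * r + 5) d
    Z.source P hP hsep fun a c p o hpP hp hro =>
      pathwidth_segmentGraph_le G Z hnbp.1 hro hp r (fun b p₁ p₂ hpp hp₁ hp₂ M hM hsplit hcard =>
        hcon ⟨a, b, c, ⟨M, hM, hsplit, hcard⟩, p₁, p₂, hp₁, hp₂, fun x hx =>
          htrue p hpP x (hpp ▸ Z.occurs_append.2 hx)⟩) o
  have hsup : (⨆ i, f i) = G := by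
    refine le_antisymm (iSup_le hf₁) fun u v huv => ?_
    rw [SimpleGraph.iSup_adj]
    exact hf₃ u v huv (hitByAll_source_sink hmon hrep huv)
  have : dPathwidth d G ≤ 4 * r + 5 := Nat.sInf_le ⟨f, hf₁, hsup, hf₂⟩
  omega

theorem four_pow_le_of_isSMNBP {V : Type} [Fintype V] [DecidableEq V] {G : SimpleGraph V}
    {d r : ℕ} {Z : BP (PsiVar V)} (hG : 4 * r + 5 < dPathwidth d G) (hZ : Z.IsSMNBP d)
    (hrep : RepresentsPsi G Z) : 4 ^ (r + 1) ≤ 3 ^ (r + 1) * (Z.m + 1) ^ 3 := by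
  classical
  let T : Fin Z.n × Fin Z.n × Fin Z.n → Finset (V → Bool) := fun κ =>
    Finset.univ.filter fun τ =>
      (∃ M : Finset (V × V), PairwiseVertexDisjoint M ∧
        (∀ e ∈ M, IsSplit G Z κ.1 κ.2.1 κ.2.2 e.1 e.2) ∧ M.card = r + 1) ∧
      ∃ p q, Z.IsPathFrom κ.1 κ.2.1 p ∧ Z.IsPathFrom κ.2.1 κ.2.2 q ∧
        ∀ x, Z.Occurs p x ∨ Z.Occurs q x → edgeCompletion τ x = true
  have hT : ∀ κ, 4 ^ (r + 1) * (T κ).card ≤ 3 ^ (r + 1) * Fintype.card (V → Bool) := by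
    intro κ
    by_cases hM : ∃ M : Finset (V × V), PairwiseVertexDisjoint M ∧
        (∀ e ∈ M, IsSplit G Z κ.1 κ.2.1 κ.2.2 e.1 e.2) ∧ M.card = r + 1
    · obtain ⟨M, hdisj, hsplit, hcard⟩ := hM
      have hpat : ∀ e : V × V, ∃ β : Bool × Bool, IsSplit G Z κ.1 κ.2.1 κ.2.2 e.1 e.2 →
          ∀ τ : V → Bool, (∃ p q, Z.IsPathFrom κ.1 κ.2.1 p ∧ Z.IsPathFrom κ.2.1 κ.2.2 q ∧
            ∀ x, Z.Occurs p x ∨ Z.Occurs q x → edgeCompletion τ x = true) →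
            (τ e.1, τ e.2) ≠ β := by
        intro e
        by_cases he : IsSplit G Z κ.1 κ.2.1 κ.2.2 e.1 e.2
        · obtain ⟨β, hβ⟩ := he.exists_avoided_pattern
          exact ⟨β, fun _ => hβ⟩
        · exact ⟨(true, true), fun h => absurd h he⟩
      choose pat hpat using hpat
      have := card_avoiding_pattern_le pat M (fun e he => (hsplit e he).1.ne) hdisj
      rw [hcard] at this
      refine (Nat.mul_le_mul_left _ (Finset.card_le_card fun τ hτ => ?_)).trans this
      rw [Finset.mem_filter] at hτ ⊢
      exact ⟨Finset.mem_univ _, fun e he => hpat e (hsplit e he) τ hτ.2.2⟩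
    · have : T κ = ∅ := Finset.filter_eq_empty_iff.2 fun τ _ h => hM h.1
      simp [this]
  have hcover : (Finset.univ : Finset (V → Bool)) ⊆ Finset.univ.biUnion T := by
    intro τ _
    obtain ⟨a, b, c, h⟩ := exists_split_matching hG hZ hrep τ
    exact Finset.mem_biUnion.2 ⟨(a, b, c), Finset.mem_univ _,
      Finset.mem_filter.2 ⟨Finset.mem_univ _, h⟩⟩
  have hpos : 0 < Fintype.card (V → Bool) := Fintype.card_pos
  have hle : Fintype.card (V → Bool) ≤ ∑ κ, (T κ).card :=
    (Finset.card_le_card hcover).trans Finset.card_biUnion_le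
  have hsum : 4 ^ (r + 1) * Fintype.card (V → Bool) ≤
      Z.n ^ 3 * 3 ^ (r + 1) * Fintype.card (V → Bool) := by
    calc 4 ^ (r + 1) * Fintype.card (V → Bool) ≤ 4 ^ (r + 1) * ∑ κ, (T κ).card :=
          Nat.mul_le_mul_left _ hle
      _ = ∑ κ, 4 ^ (r + 1) * (T κ).card := Finset.mul_sum _ _ _
      _ ≤ ∑ _κ : Fin Z.n × Fin Z.n × Fin Z.n, 3 ^ (r + 1) * Fintype.card (V → Bool) :=
          Finset.sum_le_sum fun κ _ => hT κ
      _ = Z.n ^ 3 * 3 ^ (r + 1) * Fintype.card (V → Bool) := by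
          simp only [Finset.sum_const, Finset.card_univ, Fintype.card_prod, Fintype.card_fin,
            smul_eq_mul]
          ring
  have h1 : 4 ^ (r + 1) ≤ Z.n ^ 3 * 3 ^ (r + 1) := Nat.le_of_mul_le_mul_right hsum hpos
  have h2 : Z.n ^ 3 ≤ (Z.m + 1) ^ 3 := Nat.pow_le_pow_left hZ.1.card_vertices_le 3
  calc 4 ^ (r + 1) ≤ Z.n ^ 3 * 3 ^ (r + 1) := h1
    _ ≤ (Z.m + 1) ^ 3 * 3 ^ (r + 1) := Nat.mul_le_mul_right _ h2
    _ = _ := Nat.mul_comm _ _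

theorem dPathwidth_eq_zero_of_isEmpty {V : Type} [IsEmpty V] {d : ℕ} (hd : 1 ≤ d)
    (G : SimpleGraph V) : dPathwidth d G = 0 := by
  refine Nat.le_zero.1 (Nat.sInf_le ⟨fun _ => G, fun _ => le_rfl, ?_, fun _ => ?_⟩)
  · have : Nonempty (Fin d) := ⟨⟨0, hd⟩⟩
    exact iSup_const
  · exact Nat.sInf_le ⟨⟨0, fun i => i.elim0, fun v => isEmptyElim v, fun v => isEmptyElim v,
      fun v => isEmptyElim v⟩, fun i => i.elim0⟩

theorem one_le_card_edges {V : Type} [DecidableEq V] {G : SimpleGraph V}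
    {d : ℕ} {Z : BP (PsiVar V)} (hd : 1 ≤ d) (hG : 1 ≤ dPathwidth d G)
    (hiso : ∀ v : V, ∃ u, G.Adj v u) (hZ : Z.IsSMNBP d) (hrep : RepresentsPsi G Z) :
    1 ≤ Z.m := by
  rcases isEmpty_or_nonempty V with hV | ⟨⟨v⟩⟩
  · rw [dPathwidth_eq_zero_of_isEmpty hd] at hG
    omega
  · obtain ⟨u, hu⟩ := hiso v
    obtain ⟨p, hp⟩ := (hZ.1.2.2.2 Z.sink).1
    obtain ⟨x, -, e, -, -⟩ := hitByAll_source_sink hZ.2.1 hrep hu p hp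
    exact Nat.one_le_of_lt (lt_of_le_of_lt (Nat.zero_le _) e.2)

theorem rpow_le_of_isSMNBP {V : Type} [Fintype V] [DecidableEq V] {G : SimpleGraph V}
    {d k : ℕ} {Z : BP (PsiVar V)} (hd : 1 ≤ d) (hk : 1 ≤ k) (hiso : ∀ v : V, ∃ u, G.Adj v u)
    (hG : k ≤ dPathwidth d G) (hZ : Z.IsSMNBP d) (hrep : RepresentsPsi G Z) :
    (8 / 7 : ℝ) ^ (((k / 4 : ℕ) : ℝ) / 3) ≤ (Z.m : ℝ) + 1 := by
  have hm : (1 : ℝ) ≤ Z.m := by exact_mod_cast one_le_card_edges hd (hk.trans hG) hiso hZ hrep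
  suffices h : (8 / 7 : ℝ) ^ (k / 4) ≤ ((Z.m : ℝ) + 1) ^ 3 by
    have h0 : (8 / 7 : ℝ) ^ (((k / 4 : ℕ) : ℝ) / 3) =
        ((8 / 7 : ℝ) ^ (k / 4)) ^ ((1 : ℝ) / 3) := by
      rw [← Real.rpow_natCast, ← Real.rpow_mul (by norm_num)]
      congr 1
      ring
    have h1 : ((Z.m : ℝ) + 1) = (((Z.m : ℝ) + 1) ^ 3) ^ ((1 : ℝ) / 3) := by
      rw [← Real.rpow_natCast, ← Real.rpow_mul (by positivity)]
      norm_num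
    rw [h0, h1]
    exact Real.rpow_le_rpow (by positivity) h (by norm_num)
  have hcube : (8 : ℝ) ≤ ((Z.m : ℝ) + 1) ^ 3 := by
    calc (8 : ℝ) = 2 ^ 3 := by norm_num
      _ ≤ _ := pow_le_pow_left₀ (by norm_num) (by linarith) 3
  rcases Nat.lt_or_ge (k / 4) 2 with hr | hr
  · have : (8 / 7 : ℝ) ^ (k / 4) ≤ (8 / 7 : ℝ) ^ 1 :=
      pow_le_pow_right₀ (by norm_num) (by omega)
    linarith
  · obtain ⟨r, hr'⟩ := Nat.exists_eq_add_of_le' hr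
    have h := four_pow_le_of_isSMNBP (r := r) (by omega) hZ hrep
    have h' : (4 : ℝ) ^ (r + 1) ≤ 3 ^ (r + 1) * ((Z.m : ℝ) + 1) ^ 3 := by exact_mod_cast h
    have h43 : (4 / 3 : ℝ) ^ (r + 1) ≤ ((Z.m : ℝ) + 1) ^ 3 := by
      rw [div_pow, div_le_iff₀ (by positivity)]
      linarith
    refine le_trans ?_ h43
    rw [hr']
    calc (8 / 7 : ℝ) ^ (r + 2) = (8 / 7) ^ r * (64 / 49) := by ring
      _ ≤ (4 / 3) ^ r * (4 / 3) :=
          mul_le_mul (pow_le_pow_left₀ (by norm_num) (by norm_num) r) (by norm_num) (by norm_num)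
            (by positivity)
      _ = _ := by ring

/-- if `d-pw(G) ≥ k` and `Z` is a `d`-SMNBP representing `ψ(G)`,
then `|Z| ≥ ((8/7)^(⌊k/4⌋/3) − 1)/3`; in particular, there is an absolute
constant `c > 0` (independent of `d`, `k` and `G`) with `|Z| ≥ c·β^k`,
where `β = (8/7)^(1/12)`. -/
theorem smnbp_lower_bound :
    (∀ (V : Type) [Fintype V] [DecidableEq V] (G : SimpleGraph V) (d k : ℕ)
        (Z : BP (PsiVar V)), 1 ≤ d → 1 ≤ k → (∀ v : V, ∃ u, G.Adj v u) →
        k ≤ dPathwidth d G → Z.IsSMNBP d → RepresentsPsi G Z →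
        ((8 / 7 : ℝ) ^ (((k / 4 : ℕ) : ℝ) / 3) - 1) / 3 ≤ (Z.m : ℝ)) ∧
    ∃ c : ℝ, 0 < c ∧
      ∀ (V : Type) [Fintype V] [DecidableEq V] (G : SimpleGraph V) (d k : ℕ)
        (Z : BP (PsiVar V)), 1 ≤ d → 1 ≤ k → (∀ v : V, ∃ u, G.Adj v u) →
        k ≤ dPathwidth d G → Z.IsSMNBP d → RepresentsPsi G Z →
        c * ((8 / 7 : ℝ) ^ ((1 : ℝ) / 12)) ^ k ≤ (Z.m : ℝ) := by
  refine ⟨?_, 1 / 4, by norm_num, ?_⟩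
  · intro V _ _ G d k Z hd hk hiso hG hZ hrep
    have h := rpow_le_of_isSMNBP hd hk hiso hG hZ hrep
    have hm : (0 : ℝ) ≤ Z.m := Nat.cast_nonneg _
    linarith
  · intro V _ _ G d k Z hd hk hiso hG hZ hrep
    have h := rpow_le_of_isSMNBP hd hk hiso hG hZ hrep
    have hm : (1 : ℝ) ≤ Z.m := by exact_mod_cast one_le_card_edges hd (hk.trans hG) hiso hZ hrep
    have hk4 : (k : ℝ) ≤ 4 * ((k / 4 : ℕ) : ℝ) + 3 := by
      have : k ≤ 4 * (k / 4) + 3 := by omega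
      exact_mod_cast this
    have hpow : ((8 / 7 : ℝ) ^ ((1 : ℝ) / 12)) ^ k ≤
        (8 / 7 : ℝ) ^ (((k / 4 : ℕ) : ℝ) / 3) * (8 / 7) := by
      rw [← Real.rpow_natCast, ← Real.rpow_mul (by norm_num), ← Real.rpow_add_one (by norm_num)]
      exact Real.rpow_le_rpow_of_exponent_le (by norm_num) (by linarith)
    linarith
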